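/- Let A = σ(R)⟨x_1,…,x_n⟩ be a bijective skew PBW extension of a ring R. If R is a left p.q.-Baer ring and R is (Σ,Δ)-compatible, then A has Property (a.c.) on the left. -/

import Mathlib

/-! Basic annihilator-condition definitions for (noncommutative) rings. -/

/-- The right annihilator `r_S(X) = {a ∈ S | Xa = 0}` of a subset `X` of a ring `S`. -/
def rAnn {S : Type*} [Ring S] (X : Set S) : Set S := {a | ∀ x ∈ X, x * a = 0}

/-- The left annihilator `ℓ_S(X) = {a ∈ S | aX = 0}` of a subset `X` of a ring `S`. -/
def lAnn {S : Type*} [Ring S] (X : Set S) : Set S := {a | ∀ x ∈ X, a * x = 0}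

/-- The principal right ideal `xS` of a ring `S`. -/
def rIdeal {S : Type*} [Ring S] (x : S) : Set S := Set.range fun s => x * s

/-- The principal left ideal `Sx` of a ring `S`. -/
def lIdeal {S : Type*} [Ring S] (x : S) : Set S := Set.range fun s => s * x

/-- A ring `S` is Baer if the right annihilator of every nonempty subset is
generated (as a right ideal) by an idempotent. -/
def IsBaerRing (S : Type*) [Ring S] : Prop :=
  ∀ X : Set S, X.Nonempty → ∃ e : S, e * e = e ∧ rAnn X = rIdeal e

/-- A ring `S` is a right p.p.-ring if the right annihilator of every element is
generated by an idempotent. -/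
def IsRightPP (S : Type*) [Ring S] : Prop :=
  ∀ a : S, ∃ e : S, e * e = e ∧ rAnn {a} = rIdeal e

/-- A ring `S` is a left p.p.-ring if the left annihilator of every element is
generated by an idempotent. -/
def IsLeftPP (S : Type*) [Ring S] : Prop :=
  ∀ a : S, ∃ e : S, e * e = e ∧ lAnn {a} = lIdeal e

/-- A ring `S` is right p.q.-Baer if the right annihilator of every principal right
ideal is generated by an idempotent. -/
def IsRightPQBaer (S : Type*) [Ring S] : Prop :=
  ∀ a : S, ∃ e : S, e * e = e ∧ rAnn (rIdeal a) = rIdeal e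

/-- A ring `S` is left p.q.-Baer if the left annihilator of every principal left
ideal is generated by an idempotent. -/
def IsLeftPQBaer (S : Type*) [Ring S] : Prop :=
  ∀ a : S, ∃ e : S, e * e = e ∧ lAnn (lIdeal a) = lIdeal e

/-- Property (a.c.) on the right: for every finitely generated right ideal
`I = a₁S + ⋯ + a_mS` there is `c` with `r_S(I) = r_S(cS)`. -/
def HasRightAC (S : Type*) [Ring S] : Prop :=
  ∀ (m : ℕ) (a : Fin m → S), ∃ c : S,
    rAnn {y : S | ∃ s : Fin m → S, y = ∑ i, a i * s i} = rAnn (rIdeal c)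

/-- Property (a.c.) on the left: for every finitely generated left ideal
`I = Sa₁ + ⋯ + Sa_m` there is `c` with `ℓ_S(I) = ℓ_S(Sc)`. -/
def HasLeftAC (S : Type*) [Ring S] : Prop :=
  ∀ (m : ℕ) (a : Fin m → S), ∃ c : S,
    lAnn {y : S | ∃ s : Fin m → S, y = ∑ i, s i * a i} = lAnn (lIdeal c)

/-- A ring is Abelian if every idempotent is central. -/
def IsAbelianRing (S : Type*) [Ring S] : Prop :=
  ∀ e : S, e * e = e → ∀ r : S, e * r = r * e

/-- A ring `S` is NI if the set of nilpotent elements coincides with the upper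
nilradical `nil*(S)`, the sum of all (two-sided) nil ideals of `S`. -/
def IsNIRing (S : Type*) [Ring S] : Prop :=
  {a : S | IsNilpotent a} =
    ((sSup {I : TwoSidedIdeal S | ∀ x ∈ I, IsNilpotent x} : TwoSidedIdeal S) : Set S)

/-- `σ^α = σ₁^{α₁} ∘ ⋯ ∘ σₙ^{αₙ}` for a family of ring endomorphisms. -/
def sigmaPow {R : Type*} [Ring R] {n : ℕ} (σ : Fin n → R →+* R) (α : Fin n → ℕ) : R → R :=
  (List.ofFn fun i => (⇑(σ i))^[α i]).foldr (· ∘ ·) id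

/-- `δ^α = δ₁^{α₁} ∘ ⋯ ∘ δₙ^{αₙ}` for a family of maps. -/
def deltaPow {R : Type*} {n : ℕ} (δ : Fin n → R → R) (α : Fin n → ℕ) : R → R :=
  (List.ofFn fun i => (δ i)^[α i]).foldr (· ∘ ·) id

/-- The ordered standard monomial `x^α = x₁^{α₁} ⋯ xₙ^{αₙ}`. -/
def monom {A : Type*} [Ring A] {n : ℕ} (x : Fin n → A) (α : Fin n → ℕ) : A :=
  (List.ofFn fun i => x i ^ α i).prod

/-- A skew PBW extension `A = σ(R)⟨x₁,…,xₙ⟩` of a ring `R`: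
`R` embeds in `A` (sharing the identity), `A` is a free left `R`-module with basis the
standard monomials, there are injective endomorphisms `σᵢ` and `σᵢ`-derivations `δᵢ`
with `xᵢ r = σᵢ(r) xᵢ + δᵢ(r)`, and `xⱼxᵢ - d_{i,j} xᵢxⱼ ∈ R + Rx₁ + ⋯ + Rxₙ`
with `d_{i,j} ≠ 0`. -/
structure SkewPBWExt (R A : Type*) [Ring R] [Ring A] (n : ℕ) where
  /-- the inclusion of `R` into `A` -/
  ι : R →+* A
  ι_inj : Function.Injective ι
  /-- the variables `x₁, …, xₙ` -/
  x : Fin n → A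
  /-- the endomorphisms `σᵢ` -/
  σ : Fin n → R →+* R
  σ_inj : ∀ i, Function.Injective (σ i)
  /-- the `σᵢ`-derivations `δᵢ` -/
  δ : Fin n → R → R
  δ_add : ∀ (i : Fin n) (a b : R), δ i (a + b) = δ i a + δ i b
  δ_leibniz : ∀ (i : Fin n) (a b : R), δ i (a * b) = σ i a * δ i b + δ i a * b
  comm_rel : ∀ (i : Fin n) (r : R), x i * ι r = ι (σ i r) * x i + ι (δ i r)
  /-- `A` is a free left `R`-module with basis the standard monomials: every element
  has a unique representation as a finite left `R`-linear combination of monomials. -/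
  basis : ∀ f : A, ∃! c : (Fin n → ℕ) →₀ R, f = c.sum fun α r => ι r * monom x α
  /-- the constants `d_{i,j}` -/
  d : Fin n → Fin n → R
  d_ne : ∀ i j, d i j ≠ 0
  quad : ∀ i j, ∃ (r0 : R) (rc : Fin n → R),
    x j * x i - ι (d i j) * (x i * x j) = ι r0 + ∑ k, ι (rc k) * x k

namespace SkewPBWExt

variable {R A : Type*} [Ring R] [Ring A] {n : ℕ}

/-- `R` is `(Σ,Δ)`-compatible. -/
def SigmaDeltaCompatible (E : SkewPBWExt R A n) : Prop :=
  ∀ (a b : R) (α : Fin n → ℕ),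
    (a * b = 0 ↔ a * sigmaPow E.σ α b = 0) ∧ (a * b = 0 → a * deltaPow E.δ α b = 0)

/-- `R` is `Σ`-rigid. -/
def SigmaRigid (E : SkewPBWExt R A n) : Prop :=
  ∀ (a : R) (α : Fin n → ℕ), a * sigmaPow E.σ α a = 0 → a = 0

/-- Condition (SA1): if `fg = 0` in `A` then all products of coefficients vanish. -/
def SA1 (E : SkewPBWExt R A n) : Prop :=
  ∀ cf cg : (Fin n → ℕ) →₀ R,
    (cf.sum fun α r => E.ι r * monom E.x α) * (cg.sum fun β r => E.ι r * monom E.x β) = 0 →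
    ∀ α β, cf α * cg β = 0

/-- The extension is bijective: every `σᵢ` is bijective and every `d_{i,j}` (`i < j`)
is invertible in `R`. -/
def Bijective (E : SkewPBWExt R A n) : Prop :=
  (∀ i, Function.Bijective (E.σ i)) ∧ ∀ i j : Fin n, i < j → IsUnit (E.d i j)

end SkewPBWExt


lemma foldr_comp_ofFn_iterate_single {T : Type*} {n : ℕ} (f : Fin n → T → T) (i : Fin n) :
    (List.ofFn fun j => (f j)^[(Pi.single i 1 : Fin n → ℕ) j]).foldr (· ∘ ·) id = f i := by
  have hzero : ∀ {m : ℕ}, (List.ofFn fun _ : Fin m => (id : T → T)).foldr (· ∘ ·) id = id := by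
    intro m
    induction m with
    | zero => rfl
    | succ m ih => rw [List.ofFn_succ, List.foldr_cons, ih]; rfl
  induction n with
  | zero => exact i.elim0
  | succ n ih =>
    rw [List.ofFn_succ, List.foldr_cons]
    refine Fin.cases ?_ (fun k => ?_) i
    · have h : (fun j : Fin n => (f j.succ)^[(Pi.single 0 1 : Fin (n + 1) → ℕ) j.succ]) =
          fun _ => id := by
        funext j
        simp
      rw [h, hzero]
      simp
    · have h : (fun j : Fin n => (f j.succ)^[(Pi.single k.succ 1 : Fin (n + 1) → ℕ) j.succ]) =
          fun j => (f j.succ)^[(Pi.single k 1 : Fin n → ℕ) j] := by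
        funext j
        simp [Pi.single_apply]
      rw [h, ih (fun j => f j.succ) k]
      simp

/-- The nondecreasing word in which the letter `i` occurs `α i` times. -/
def sortedWord {n : ℕ} (α : Fin n → ℕ) : List (Fin n) :=
  (List.ofFn fun i => List.replicate (α i) i).flatten

lemma count_sortedWord {n : ℕ} (α : Fin n → ℕ) (j : Fin n) :
    (sortedWord α).count j = α j := by
  simp [sortedWord, List.count_flatten, List.map_ofFn, List.sum_ofFn, Function.comp_def,
    List.count_replicate]

lemma length_sortedWord {n : ℕ} (α : Fin n → ℕ) : (sortedWord α).length = ∑ i, α i := by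
  simp [sortedWord, List.length_flatten, List.map_ofFn, List.sum_ofFn, Function.comp_def]

lemma monom_eq_prod_sortedWord {A : Type*} [Ring A] {n : ℕ} (x : Fin n → A) (α : Fin n → ℕ) :
    monom x α = ((sortedWord α).map x).prod := by
  simp [monom, sortedWord, List.map_flatten, List.prod_flatten, List.map_ofFn, Function.comp_def]

lemma perm_sortedWord_count {n : ℕ} (l : List (Fin n)) :
    l.Perm (sortedWord fun i => l.count i) :=
  List.perm_iff_count.2 fun i => (count_sortedWord (fun i => l.count i) i).symm

/-- The degree-lexicographic key of an exponent. -/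
def degLexKey {n : ℕ} (α : Fin n → ℕ) : ℕ ×ₗ Lex (Fin n → ℕ) := toLex (∑ i, α i, toLex α)

lemma degLexKey_add {n : ℕ} (α β : Fin n → ℕ) :
    degLexKey (α + β) = degLexKey α + degLexKey β := by
  simp only [degLexKey, Pi.add_apply, Finset.sum_add_distrib]
  rfl

lemma degLexKey_injective {n : ℕ} : Function.Injective (degLexKey (n := n)) := by
  intro α β h
  exact toLex.injective (congrArg Prod.snd (toLex.injective h))

lemma sum_le_sum_of_degLexKey_le {n : ℕ} {α β : Fin n → ℕ} (h : degLexKey α ≤ degLexKey β) :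
    ∑ i, α i ≤ ∑ i, β i := by
  rcases Prod.Lex.le_iff.1 h with h | h
  · exact h.le
  · exact h.1.le

lemma IsLeftPQBaer.exists_semicentral_idempotent {R : Type*} [Ring R] (hpq : IsLeftPQBaer R)
    (c : R) : ∃ e : R, e * e = e ∧ (∀ r, e * r * e = e * r) ∧
      ∀ a, a * e = a ↔ ∀ r, a * r * c = 0 := by
  obtain ⟨e, he, h⟩ := hpq c
  have key : ∀ a, a * e = a ↔ ∀ r, a * r * c = 0 := by
    intro a
    have ha := Set.ext_iff.1 h a
    constructor
    · intro hae r
      rw [mul_assoc]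
      exact ha.2 ⟨a, hae⟩ _ ⟨r, rfl⟩
    · intro hr
      obtain ⟨s, hs⟩ := ha.1 (by rintro _ ⟨r, rfl⟩; rw [← mul_assoc]; exact hr r)
      simp only at hs
      rw [← hs, mul_assoc, he]
  refine ⟨e, he, fun r => (key _).2 fun s => ?_, key⟩
  rw [mul_assoc e r s]
  exact (key e).1 he _

lemma IsLeftPQBaer.exists_semicentral_idempotent_finset {R : Type*} [Ring R]
    (hpq : IsLeftPQBaer R) (s : Finset R) : ∃ e : R, (∀ r, e * r * e = e * r) ∧
      ∀ a, a * e = a ↔ ∀ c ∈ s, ∀ r, a * r * c = 0 := by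
  classical
  induction s using Finset.induction_on with
  | empty => exact ⟨1, by simp, by simp⟩
  | insert c s _ ih =>
    obtain ⟨e₂, h₂, k₂⟩ := ih
    obtain ⟨e₁, i₁, h₁, k₁⟩ := hpq.exists_semicentral_idempotent c
    have i₂ : e₂ * e₂ = e₂ := by simpa using h₂ 1
    refine ⟨e₁ * e₂, fun r => ?_, fun a => ?_⟩
    · calc e₁ * e₂ * r * (e₁ * e₂) = e₁ * (e₂ * r) * e₁ * e₂ := by noncomm_ring
        _ = e₁ * (e₂ * r * e₂) := by rw [h₁]; noncomm_ring
        _ = e₁ * e₂ * r := by rw [h₂]; noncomm_ring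
    · rw [Finset.forall_mem_insert, ← k₁, ← k₂]
      constructor
      · intro h
        have hb : a * e₁ * e₂ * e₁ = a * e₁ * e₂ := by
          rw [mul_assoc, mul_assoc, ← mul_assoc e₁, h₁, mul_assoc]
        rw [← mul_assoc] at h
        rw [h] at hb
        refine ⟨hb, ?_⟩
        rwa [hb] at h
      · rintro ⟨ha, hb⟩
        rw [← mul_assoc, ha, hb]

namespace SkewPBWExt

variable {R A : Type*} [Ring R] [Ring A] {n : ℕ} (E : SkewPBWExt R A n)

/-- The product of the variables along a word. -/
def word (l : List (Fin n)) : A := (l.map E.x).prod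

lemma word_nil : E.word [] = 1 := rfl

lemma word_cons (i : Fin n) (l : List (Fin n)) : E.word (i :: l) = E.x i * E.word l := by
  simp [word]

lemma word_append (l l' : List (Fin n)) : E.word (l ++ l') = E.word l * E.word l' := by
  simp [word]

lemma monom_eq_word (α : Fin n → ℕ) : monom E.x α = E.word (sortedWord α) :=
  monom_eq_prod_sortedWord E.x α

/-- The left `R`-combinations of words of length less than `k`. -/
def filt (k : ℕ) : AddSubgroup A :=
  AddSubgroup.closure {y | ∃ (r : R) (l : List (Fin n)), l.length < k ∧ y = E.ι r * E.word l}

variable {E}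

lemma mul_word_mem_filt (r : R) {l : List (Fin n)} {k : ℕ} (h : l.length < k) :
    E.ι r * E.word l ∈ E.filt k :=
  AddSubgroup.subset_closure ⟨r, l, h, rfl⟩

lemma filt_mono {j k : ℕ} (h : j ≤ k) : E.filt j ≤ E.filt k := by
  apply AddSubgroup.closure_mono
  rintro _ ⟨r, l, hl, rfl⟩
  exact ⟨r, l, hl.trans_le h, rfl⟩

lemma filt_map_le (φ : A →+ A) {j k : ℕ}
    (h : ∀ (r : R) (l : List (Fin n)), l.length < j → φ (E.ι r * E.word l) ∈ E.filt k)
    {y : A} (hy : y ∈ E.filt j) : φ y ∈ E.filt k := by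
  have : E.filt j ≤ (E.filt k).comap φ := by
    refine (AddSubgroup.closure_le _).2 ?_
    rintro _ ⟨r, l, hl, rfl⟩
    exact h r l hl
  exact this hy

lemma ι_mul_mem_filt (s : R) {k : ℕ} {y : A} (hy : y ∈ E.filt k) : E.ι s * y ∈ E.filt k := by
  refine filt_map_le (AddMonoidHom.mulLeft (E.ι s)) (fun r l hl => ?_) hy
  simp only [AddMonoidHom.coe_mulLeft]
  rw [← mul_assoc, ← map_mul]
  exact mul_word_mem_filt _ hl

lemma x_mul_mem_filt (i : Fin n) {k : ℕ} {y : A} (hy : y ∈ E.filt k) :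
    E.x i * y ∈ E.filt (k + 1) := by
  refine filt_map_le (AddMonoidHom.mulLeft (E.x i)) (fun r l hl => ?_) hy
  simp only [AddMonoidHom.coe_mulLeft]
  rw [← mul_assoc, E.comm_rel, add_mul, mul_assoc, ← word_cons]
  exact add_mem (mul_word_mem_filt _ (by simpa using hl)) (mul_word_mem_filt _ (by omega))

lemma mul_word_mem_filt_add {l : List (Fin n)} {k : ℕ} {y : A} (hy : y ∈ E.filt k) :
    y * E.word l ∈ E.filt (k + l.length) := by
  refine filt_map_le (AddMonoidHom.mulRight (E.word l)) (fun r l' hl => ?_) hy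
  simp only [AddMonoidHom.mulRight_apply]
  rw [mul_assoc, ← word_append]
  exact mul_word_mem_filt _ (by simpa using hl)

variable (E) in
/-- The composite of the endomorphisms `σᵢ` along a word. -/
def wordSigma (l : List (Fin n)) (r : R) : R := l.foldr (fun i s => E.σ i s) r

lemma word_mul_ι (l : List (Fin n)) (r : R) :
    E.word l * E.ι r - E.ι (E.wordSigma l r) * E.word l ∈ E.filt l.length := by
  induction l with
  | nil => simp [word_nil, wordSigma]
  | cons i l ih =>
    have h₁ := x_mul_mem_filt i ih
    have h₂ : E.ι (E.δ i (E.wordSigma l r)) * E.word l ∈ E.filt (l.length + 1) :=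
      mul_word_mem_filt _ (by omega)
    have h := add_mem h₁ h₂
    have hσ : E.wordSigma (i :: l) r = E.σ i (E.wordSigma l r) := rfl
    rw [List.length_cons, word_cons, hσ]
    convert h using 1
    rw [mul_sub, ← mul_assoc (E.x i) (E.ι _), E.comm_rel]
    noncomm_ring

lemma x_mul_x_sub_mem (i j : Fin n) :
    E.x j * E.x i - E.ι (E.d i j) * (E.x i * E.x j) ∈ E.filt 2 := by
  obtain ⟨r₀, rc, h⟩ := E.quad i j
  rw [h]
  refine add_mem ?_ (sum_mem fun k _ => ?_)
  · simpa [word_nil] using mul_word_mem_filt (E := E) r₀ (l := []) (k := 2) (by simp)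
  · simpa [word_nil, word_cons] using
      mul_word_mem_filt (E := E) (rc k) (l := [k]) (k := 2) (by simp)

lemma Bijective.exists_unit_swap (hbij : E.Bijective) (i j : Fin n) :
    ∃ u : R, IsUnit u ∧ E.x j * E.x i - E.ι u * (E.x i * E.x j) ∈ E.filt 2 := by
  rcases lt_trichotomy i j with h | rfl | h
  · exact ⟨_, hbij.2 i j h, x_mul_x_sub_mem i j⟩
  · exact ⟨1, isUnit_one, by simp⟩
  · obtain ⟨u, hu⟩ := hbij.2 j i h
    refine ⟨↑u⁻¹, Units.isUnit _, ?_⟩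
    have h₁ := ι_mul_mem_filt (-(↑u⁻¹ : R)) (x_mul_x_sub_mem (E := E) j i)
    convert h₁ using 1
    rw [← hu, mul_sub, ← mul_assoc (E.ι _) (E.ι _), ← map_mul]
    simp
    abel

lemma Bijective.exists_unit_of_perm (hbij : E.Bijective) {l l' : List (Fin n)}
    (h : l.Perm l') :
    ∃ u : R, IsUnit u ∧ E.word l - E.ι u * E.word l' ∈ E.filt l.length := by
  induction h with
  | nil => exact ⟨1, isUnit_one, by simp⟩
  | @cons i l l' hp ih =>
    obtain ⟨u, hu, h⟩ := ih
    refine ⟨E.σ i u, hu.map _, ?_⟩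
    have h₂ : E.ι (E.δ i u) * E.word l' ∈ E.filt (l.length + 1) :=
      mul_word_mem_filt _ (by rw [hp.length_eq]; omega)
    rw [List.length_cons]
    convert add_mem (x_mul_mem_filt i h) h₂ using 1
    rw [mul_sub, ← mul_assoc (E.x i) (E.ι _), E.comm_rel, word_cons, word_cons]
    noncomm_ring
  | swap i j l =>
    obtain ⟨u, hu, h⟩ := hbij.exists_unit_swap i j
    refine ⟨u, hu, ?_⟩
    rw [List.length_cons, List.length_cons, add_assoc, add_comm]
    convert mul_word_mem_filt_add (l := l) h using 1
    simp only [word_cons]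
    noncomm_ring
  | @trans l₁ l₂ l₃ hp _ ih₁ ih₂ =>
    obtain ⟨u, hu, h⟩ := ih₁
    obtain ⟨v, hv, h'⟩ := ih₂
    refine ⟨u * v, hu.mul hv, ?_⟩
    rw [← hp.length_eq] at h'
    convert add_mem h (ι_mul_mem_filt u h') using 1
    rw [map_mul]
    noncomm_ring

/-- The leading-term formula for the product of two terms. -/
lemma Bijective.exists_unit_term_mul (hbij : E.Bijective) (α β : Fin n → ℕ) :
    ∃ u : R, IsUnit u ∧ ∀ a b : R,
      E.ι a * monom E.x α * (E.ι b * monom E.x β) -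
        E.ι (a * E.wordSigma (sortedWord α) b * u) * monom E.x (α + β) ∈
          E.filt (∑ i, α i + ∑ i, β i) := by
  have hp : (sortedWord α ++ sortedWord β).Perm (sortedWord (α + β)) := by
    refine List.perm_iff_count.2 fun i => ?_
    simp [List.count_append, count_sortedWord]
  obtain ⟨u, hu, h⟩ := hbij.exists_unit_of_perm hp
  refine ⟨u, hu, fun a b => ?_⟩
  rw [List.length_append, length_sortedWord, length_sortedWord, word_append] at h
  have h₁ := mul_word_mem_filt_add (l := sortedWord β) (word_mul_ι (E := E) (sortedWord α) b)
  rw [length_sortedWord, length_sortedWord] at h₁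
  convert ι_mul_mem_filt a (add_mem h₁
    (ι_mul_mem_filt (E.wordSigma (sortedWord α) b) h)) using 1
  simp only [monom_eq_word, map_mul]
  noncomm_ring

variable (E) in
/-- The element of `A` with given coefficients. -/
noncomputable def ofCoeff : ((Fin n → ℕ) →₀ R) →+ A :=
  Finsupp.liftAddHom fun α => (AddMonoidHom.mulRight (monom E.x α)).comp E.ι.toAddMonoidHom

lemma ofCoeff_apply (c : (Fin n → ℕ) →₀ R) :
    E.ofCoeff c = c.sum fun α r => E.ι r * monom E.x α := rfl

lemma ofCoeff_single (α : Fin n → ℕ) (r : R) :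
    E.ofCoeff (Finsupp.single α r) = E.ι r * monom E.x α := by
  simp [ofCoeff]

lemma ofCoeff_bijective : Function.Bijective E.ofCoeff := by
  refine Function.bijective_iff_existsUnique _ |>.2 fun f => ?_
  simpa only [ofCoeff_apply, eq_comm] using E.basis f

variable (E) in
/-- The coefficients of an element of `A`. -/
noncomputable def coeff : A ≃+ ((Fin n → ℕ) →₀ R) :=
  (AddEquiv.ofBijective E.ofCoeff ofCoeff_bijective).symm

lemma coeff_ofCoeff (c : (Fin n → ℕ) →₀ R) : E.coeff (E.ofCoeff c) = c :=
  (AddEquiv.ofBijective E.ofCoeff ofCoeff_bijective).symm_apply_apply c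

lemma ofCoeff_coeff (f : A) : E.ofCoeff (E.coeff f) = f :=
  (AddEquiv.ofBijective E.ofCoeff ofCoeff_bijective).apply_symm_apply f

lemma coeff_term (α : Fin n → ℕ) (r : R) :
    E.coeff (E.ι r * monom E.x α) = Finsupp.single α r := by
  rw [← ofCoeff_single, coeff_ofCoeff]

lemma Bijective.coeff_eq_zero_of_mem_filt (hbij : E.Bijective) {k : ℕ} {y : A}
    (hy : y ∈ E.filt k) {γ : Fin n → ℕ} (hγ : k ≤ ∑ i, γ i) : E.coeff y γ = 0 := by
  induction k generalizing y γ with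
  | zero =>
    have : y ∈ (⊥ : AddSubgroup A) := by simpa [filt] using hy
    rw [AddSubgroup.mem_bot.1 this]
    simp
  | succ k ih =>
    let φ : A →+ R := (Finsupp.applyAddHom γ).comp E.coeff.toAddMonoidHom
    suffices E.filt (k + 1) ≤ φ.ker from this hy
    refine (AddSubgroup.closure_le _).2 ?_
    rintro _ ⟨r, l, hl, rfl⟩
    change E.coeff (E.ι r * E.word l) γ = 0
    obtain ⟨u, -, hu⟩ := hbij.exists_unit_of_perm (perm_sortedWord_count l)
    rw [← monom_eq_word] at hu
    have hlen : l.length = ∑ i, l.count i := by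
      rw [(perm_sortedWord_count l).length_eq, length_sortedWord]
    have h := ih (filt_mono (by omega) (ι_mul_mem_filt r hu)) (γ := γ) (by omega)
    rw [mul_sub, ← mul_assoc, ← map_mul, map_sub, coeff_term, Finsupp.sub_apply,
      Finsupp.single_eq_of_ne, sub_zero] at h
    · exact h
    · rintro rfl
      exact absurd hγ (hlen ▸ hl).not_ge

lemma SigmaDeltaCompatible.mul_σ (hcomp : E.SigmaDeltaCompatible) (i : Fin n) (a b : R) :
    a * b = 0 ↔ a * E.σ i b = 0 := by
  have h := (hcomp a b (Pi.single i 1)).1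
  rwa [sigmaPow, foldr_comp_ofFn_iterate_single (fun j => ⇑(E.σ j)) i] at h

lemma SigmaDeltaCompatible.mul_δ (hcomp : E.SigmaDeltaCompatible) (i : Fin n) {a b : R}
    (hab : a * b = 0) : a * E.δ i b = 0 := by
  have h := (hcomp a b (Pi.single i 1)).2 hab
  rwa [deltaPow, foldr_comp_ofFn_iterate_single E.δ i] at h

lemma SigmaDeltaCompatible.mul_wordSigma (hcomp : E.SigmaDeltaCompatible) (l : List (Fin n))
    (a b : R) : a * b = 0 ↔ a * E.wordSigma l b = 0 := by
  induction l with
  | nil => rfl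
  | cons i l ih => exact ih.trans (hcomp.mul_σ i a _)

lemma SigmaDeltaCompatible.ι_mul_word_mul_ι (hcomp : E.SigmaDeltaCompatible)
    (l : List (Fin n)) {a c : R} (h : ∀ r, a * r * c = 0) :
    E.ι a * E.word l * E.ι c = 0 := by
  induction l using List.reverseRecOn generalizing c with
  | nil =>
    rw [word_nil, mul_one, ← map_mul]
    simpa using congrArg E.ι (h 1)
  | append_singleton l i ih =>
    have h₁ := ih fun r => (hcomp.mul_σ i _ _).1 (h r)
    have h₂ := ih fun r => hcomp.mul_δ i (h r)
    rw [word_append, word_cons, word_nil, mul_one, mul_assoc, mul_assoc, E.comm_rel, mul_add,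
      mul_add, ← mul_assoc, ← mul_assoc, ← mul_assoc, h₂, h₁, zero_mul, add_zero]

lemma SigmaDeltaCompatible.ι_mul_mul_ι (hcomp : E.SigmaDeltaCompatible) {a c : R}
    (h : ∀ r, a * r * c = 0) (y : A) : E.ι a * y * E.ι c = 0 := by
  rw [← ofCoeff_coeff (E := E) y, ofCoeff_apply, Finsupp.sum, Finset.mul_sum, Finset.sum_mul]
  refine Finset.sum_eq_zero fun α _ => ?_
  rw [← mul_assoc, ← map_mul, monom_eq_word]
  refine hcomp.ι_mul_word_mul_ι _ fun r => ?_
  rw [mul_assoc a]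
  exact h _

lemma SigmaDeltaCompatible.ι_mul_mul_ofCoeff (hcomp : E.SigmaDeltaCompatible) {a : R}
    {c : (Fin n → ℕ) →₀ R} (h : ∀ β r, a * r * c β = 0) (y : A) :
    E.ι a * y * E.ofCoeff c = 0 := by
  rw [ofCoeff_apply, Finsupp.sum, Finset.mul_sum]
  refine Finset.sum_eq_zero fun β _ => ?_
  rw [← mul_assoc, hcomp.ι_mul_mul_ι (h β), zero_mul]

lemma Bijective.leadingCoeff_mul (hbij : E.Bijective) (hcomp : E.SigmaDeltaCompatible)
    {cg cf : (Fin n → ℕ) →₀ R} {α₀ β₀ : Fin n → ℕ}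
    (hα : ∀ α ∈ cg.support, degLexKey α ≤ degLexKey α₀)
    (hβ : ∀ β ∈ cf.support, degLexKey β ≤ degLexKey β₀)
    (h : E.ofCoeff cg * E.ofCoeff cf = 0) : cg α₀ * cf β₀ = 0 := by
  classical
  choose u hu hterm using fun α β => hbij.exists_unit_term_mul α β
  have hmem : ∀ α ∈ cg.support, ∀ β ∈ cf.support,
      E.coeff (E.ι (cg α) * monom E.x α * (E.ι (cf β) * monom E.x β)) (α₀ + β₀) =
        if α = α₀ ∧ β = β₀ then cg α * E.wordSigma (sortedWord α) (cf β) * u α β else 0 := by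
    intro α hα' β hβ'
    have hle₁ := sum_le_sum_of_degLexKey_le (hα α hα')
    have hle₂ := sum_le_sum_of_degLexKey_le (hβ β hβ')
    have h₀ := hbij.coeff_eq_zero_of_mem_filt (hterm α β (cg α) (cf β)) (γ := α₀ + β₀)
      (by simp only [Pi.add_apply, Finset.sum_add_distrib]; omega)
    rw [map_sub, coeff_term, Finsupp.sub_apply, sub_eq_zero] at h₀
    rw [h₀, Finsupp.single_apply]
    congr 1
    refine propext ⟨fun heq => ?_, fun ⟨h₁, h₂⟩ => by rw [h₁, h₂]⟩
    have hk := congrArg degLexKey heq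
    rw [degLexKey_add, degLexKey_add] at hk
    obtain ⟨h₁, h₂⟩ := (add_eq_add_iff_eq_and_eq (hα α hα') (hβ β hβ')).1 hk
    exact ⟨degLexKey_injective h₁, degLexKey_injective h₂⟩
  by_cases hα₀ : α₀ ∈ cg.support
  swap
  · rw [Finsupp.notMem_support_iff.1 hα₀, zero_mul]
  by_cases hβ₀ : β₀ ∈ cf.support
  swap
  · rw [Finsupp.notMem_support_iff.1 hβ₀, mul_zero]
  have hsum := congrArg (fun y => E.coeff y (α₀ + β₀)) h
  simp only [ofCoeff_apply, Finsupp.sum, Finset.sum_mul_sum, map_sum, Finsupp.finsetSum_apply,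
    map_zero, Finsupp.zero_apply] at hsum
  rw [Finset.sum_eq_single_of_mem α₀ hα₀, Finset.sum_eq_single_of_mem β₀ hβ₀,
    hmem α₀ hα₀ β₀ hβ₀, if_pos ⟨rfl, rfl⟩] at hsum
  · exact (hcomp.mul_wordSigma _ _ _).2 ((hu α₀ β₀).mul_left_eq_zero.1 hsum)
  · intro β hβ' hne
    rw [hmem α₀ hα₀ β hβ', if_neg fun h => hne h.2]
  · intro α hα' hne
    refine Finset.sum_eq_zero fun β hβ' => ?_
    rw [hmem α hα' β hβ', if_neg fun h => hne h.1]

lemma ofCoeff_mapRange_mul (e : R) (c : (Fin n → ℕ) →₀ R) :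
    E.ofCoeff (c.mapRange (e * ·) (mul_zero e)) = E.ι e * E.ofCoeff c := by
  rw [ofCoeff_apply, Finsupp.sum_mapRange_index (by simp), ofCoeff_apply, Finsupp.sum, Finsupp.sum,
    Finset.mul_sum]
  simp [mul_assoc]

/-- `A` is quasi-Armendariz over a left p.q.-Baer ring. -/
lemma Bijective.coeff_mul_mul_coeff (hbij : E.Bijective) (hcomp : E.SigmaDeltaCompatible)
    (hpq : IsLeftPQBaer R) {cg cf : (Fin n → ℕ) →₀ R}
    (h : ∀ y, E.ofCoeff cg * y * E.ofCoeff cf = 0) (α β : Fin n → ℕ) (r : R) :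
    cg α * r * cf β = 0 := by
  induction hN : cg.support.card + cf.support.card using Nat.strong_induction_on
    generalizing cg cf α β r with
  | _ N ih =>
  rcases eq_or_ne cg 0 with rfl | hg
  · simp
  rcases eq_or_ne cf 0 with rfl | hf
  · simp
  obtain ⟨α₀, hα₀, hα⟩ := cg.support.exists_max_image degLexKey (Finsupp.support_nonempty_iff.2 hg)
  obtain ⟨β₀, hβ₀, hβ⟩ := cf.support.exists_max_image degLexKey (Finsupp.support_nonempty_iff.2 hf)
  have hlead : ∀ s, cg α₀ * s * cf β₀ = 0 := by
    intro s
    have hs : E.ofCoeff cg * E.ofCoeff (cf.mapRange (s * ·) (mul_zero s)) = 0 := by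
      rw [ofCoeff_mapRange_mul, ← mul_assoc, h]
    simpa [mul_assoc] using hbij.leadingCoeff_mul hcomp hα
      (fun β hβ' => hβ β (Finsupp.support_mapRange hβ')) hs
  obtain ⟨e, he, hsemi, hann⟩ := hpq.exists_semicentral_idempotent (cf β₀)
  have hae := (hann _).2 hlead
  have heb : e * cf β₀ = 0 := by simpa using (hann e).1 he 1
  have hcard : (cf.mapRange (e * ·) (mul_zero e)).support.card < cf.support.card := by
    refine Finset.card_lt_card
      (Finset.ssubset_iff_of_subset Finsupp.support_mapRange |>.2 ⟨β₀, hβ₀, ?_⟩)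
    simp [heb]
  have hrow : ∀ β s, cg α₀ * s * cf β = 0 := by
    intro β s
    have h₁ := ih _ (by omega) (cg := cg) (cf := cf.mapRange (e * ·) (mul_zero e))
      (fun y => by rw [ofCoeff_mapRange_mul, ← mul_assoc, mul_assoc _ y, h]) α₀ β (e * s) rfl
    rw [Finsupp.mapRange_apply] at h₁
    rw [← hae, mul_assoc _ e s, ← hsemi]
    simpa only [mul_assoc] using h₁
  by_cases hαα : α = α₀
  · rw [hαα]
    exact hrow β r
  have hsplit : E.ofCoeff cg = E.ι (cg α₀) * monom E.x α₀ + E.ofCoeff (cg.erase α₀) := by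
    rw [← ofCoeff_single, ← map_add, Finsupp.single_add_erase]
  have hcard' : (cg.erase α₀).support.card < cg.support.card := by
    rw [Finsupp.support_erase]
    exact Finset.card_erase_lt_of_mem hα₀
  have h₁ := ih _ (by omega) (cg := cg.erase α₀) (cf := cf) (fun y => by
    have h₂ := h y
    have h₃ := hcomp.ι_mul_mul_ofCoeff hrow (monom E.x α₀ * y)
    rw [hsplit, add_mul, add_mul, mul_assoc (E.ι _), h₃, zero_add] at h₂
    exact h₂) α β r rfl
  rwa [Finsupp.erase_ne hαα] at h₁

end SkewPBWExt

/-- If the extension is bijective and `R` is a left p.q.-Baer `(Σ,Δ)`-compatible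
ring, then the skew PBW extension `A` has Property (a.c.) on the left. -/
theorem bijective_leftPQBaer_hasLeftAC {R A : Type*} [Ring R] [Ring A] {n : ℕ} (E : SkewPBWExt R A n)
    (hbij : E.Bijective) (hpq : IsLeftPQBaer R) (hcomp : E.SigmaDeltaCompatible) :
    HasLeftAC A := by
  classical
  intro m f
  obtain ⟨e, hsemi, hann⟩ := hpq.exists_semicentral_idempotent_finset
    (Finset.univ.biUnion fun i => (E.coeff (f i)).support.image (E.coeff (f i)))
  have hann' : ∀ a, a * e = a ↔ ∀ i β r, a * r * E.coeff (f i) β = 0 := by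
    intro a
    rw [hann]
    constructor
    · intro h i β r
      by_cases hβ : β ∈ (E.coeff (f i)).support
      · exact h _ (Finset.mem_biUnion.2 ⟨i, Finset.mem_univ _, Finset.mem_image_of_mem _ hβ⟩) r
      · rw [Finsupp.notMem_support_iff.1 hβ, mul_zero]
    · intro h c hc r
      obtain ⟨i, -, hi⟩ := Finset.mem_biUnion.1 hc
      obtain ⟨β, -, rfl⟩ := Finset.mem_image.1 hi
      exact h i β r
  have hidem : e * e = e := by simpa using hsemi 1
  have hcompl : ∀ a, a * e = a → ∀ r, a * r * (1 - e) = 0 := by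
    intro a ha r
    rw [← ha, mul_assoc a e r, mul_sub, mul_one, mul_assoc a, hsemi, sub_self]
  refine ⟨E.ι (1 - e), Set.ext fun g => ⟨fun hg => ?_, fun hg => ?_⟩⟩
  · have hgf : ∀ i y, g * y * f i = 0 := by
      intro i y
      rw [mul_assoc]
      refine hg _ ⟨Pi.single i y, ?_⟩
      rw [Finset.sum_eq_single i (fun j _ hj => by rw [Pi.single_eq_of_ne hj, zero_mul])
        (by simp), Pi.single_eq_same]
    rintro _ ⟨y, rfl⟩
    simp only
    rw [← mul_assoc, ← E.ofCoeff_coeff g, E.ofCoeff_apply, Finsupp.sum, Finset.sum_mul, Finset.sum_mul]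
    refine Finset.sum_eq_zero fun α _ => ?_
    rw [mul_assoc (E.ι _)]
    refine hcomp.ι_mul_mul_ι (hcompl _ ((hann' _).2 fun i β r => ?_)) _
    refine hbij.coeff_mul_mul_coeff hcomp hpq (fun z => ?_) α β r
    rw [E.ofCoeff_coeff, E.ofCoeff_coeff]
    exact hgf i z
  · have hge : g = g * E.ι e := by
      have h := hg (E.ι (1 - e)) ⟨1, one_mul _⟩
      rwa [map_sub, map_one, mul_sub, mul_one, sub_eq_zero] at h
    rintro _ ⟨s, rfl⟩
    rw [Finset.mul_sum]
    refine Finset.sum_eq_zero fun i _ => ?_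
    have h := hcomp.ι_mul_mul_ofCoeff ((hann' e).1 hidem i) (s i)
    rw [E.ofCoeff_coeff] at h
    rw [hge, mul_assoc, ← mul_assoc (E.ι e), h, mul_zero]
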